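/- For any sufficiently small ϑ ∈ (0,1) there exists a smooth function φ : ℝ → ℝ⁺ with φ(0)=0, φ'(0)=0, φ''(0)=1, lim_{t→0⁺} φ'(t)/t = 1, such that φ is a polynomial of degree 2 in a neighborhood of +∞, the map t ↦ φ'(t)/t is strictly decreasing on (0,∞) with limit at +∞ less than ϑ, and min(φ'(t)/t, φ''(t)) ≥ σ for all t > 0 and some σ > 0 (hence φ is strictly convex on [0,∞)). -/

import Mathlib

open Set Filter Real

open scoped ContDiff in
/-- The primitive of a smooth function is smooth. -/
theorem contDiff_infty_primitive {f : ℝ → ℝ} (hf : ContDiff ℝ ∞ f) (a : ℝ) :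
    ContDiff ℝ ∞ fun t => ∫ x in a..t, f x := by
  have hd : ∀ t, HasDerivAt (fun t => ∫ x in a..t, f x) (f t) t :=
    fun t => hf.continuous.integral_hasStrictDerivAt a t |>.hasDerivAt
  refine contDiff_infty_iff_deriv.2 ⟨fun t => (hd t).differentiableAt, ?_⟩
  rwa [show deriv (fun t => ∫ x in a..t, f x) = f from funext fun t => (hd t).deriv]

/-- If `g` is antitone on `[0, ∞)` and drops strictly below `g 0` right away, then the mean value
of `g` on `[0, t]` exceeds `g t`. -/
theorem mul_lt_integral_of_antitone {g : ℝ → ℝ} (hc : Continuous g) (hg : AntitoneOn g (Ici 0))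
    (h0 : ∀ t, 0 < t → g t < g 0) {t : ℝ} (ht : 0 < t) : t * g t < ∫ x in (0 : ℝ)..t, g x := by
  have h := intervalIntegral.integral_lt_integral_of_continuousOn_of_le_of_exists_lt
    (f := fun _ => g t) (g := g) ht continuousOn_const hc.continuousOn
    (fun x hx => hg hx.1.le ht.le hx.2) ⟨0, left_mem_Icc.2 ht.le, h0 t ht⟩
  simpa using h

/-- The mean value of `g` on `[0, t]` is strictly decreasing in `t` when `g` is antitone and drops
strictly below `g 0` right away. -/
theorem strictAntiOn_integral_div {g : ℝ → ℝ} (hc : Continuous g) (hg : AntitoneOn g (Ici 0))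
    (h0 : ∀ t, 0 < t → g t < g 0) :
    StrictAntiOn (fun t => (∫ x in (0 : ℝ)..t, g x) / t) (Ioi 0) := by
  have hd : ∀ t, t ∈ Ioi (0 : ℝ) → HasDerivAt (fun t => (∫ x in (0 : ℝ)..t, g x) / t)
      ((g t * t - (∫ x in (0 : ℝ)..t, g x) * 1) / t ^ 2) t := fun t ht =>
    (hc.integral_hasStrictDerivAt 0 t).hasDerivAt.div (hasDerivAt_id t) (ne_of_gt ht)
  refine strictAntiOn_of_deriv_neg (convex_Ioi 0)
    (fun t ht => (hd t ht).continuousAt.continuousWithinAt) fun t ht => ?_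
  rw [interior_Ioi] at ht
  rw [(hd t ht).deriv]
  have := mul_lt_integral_of_antitone hc hg h0 ht
  exact div_neg_of_neg_of_pos (by linarith) (pow_pos ht 2)

/-- For every `ε < 1` there is a smooth function decreasing from `1` at `0` to the constant `ε`
on `[1, ∞)`, and smaller than `1` on `(0, ∞)`. -/
theorem exists_smooth_antitone_eventually_const {ε : ℝ} (hε : ε < 1) :
    ∃ g : ℝ → ℝ, ContDiff ℝ (⊤ : ℕ∞) g ∧ Antitone g ∧ g 0 = 1 ∧ (∀ t, 0 < t → g t < 1) ∧
      (∀ t, ε ≤ g t) ∧ ∀ t, 1 ≤ t → g t = ε := by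
  refine ⟨fun t => ε + (1 - ε) * smoothTransition (1 - t), ?_, ?_, ?_, ?_, ?_, ?_⟩
  · exact contDiff_const.add
      (contDiff_const.mul (smoothTransition.contDiff.comp (contDiff_const.sub contDiff_id)))
  · intro x y hxy
    have := smoothTransition.monotone (sub_le_sub_left hxy 1)
    dsimp only
    nlinarith
  · simp
  · intro t ht
    have := smoothTransition.lt_one_of_lt_one (x := 1 - t) (by linarith)
    dsimp only
    nlinarith
  · intro t
    have := smoothTransition.nonneg (1 - t)
    dsimp only
    nlinarith
  · intro t ht
    simp [smoothTransition.zero_of_nonpos (x := 1 - t) (by linarith)]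

/-- Proposition 2.2: existence of the auxiliary function φ associated to any
sufficiently small ϑ ∈ (0,1), satisfying (i)-(iv). -/
theorem exists_auxiliary_function :
    ∃ ϑ₀ : ℝ, 0 < ϑ₀ ∧ ∀ ϑ : ℝ, 0 < ϑ → ϑ < ϑ₀ → ϑ < 1 →
      ∃ φ : ℝ → ℝ, ContDiff ℝ (⊤ : ℕ∞) φ ∧ (∀ t : ℝ, 0 < t → 0 < φ t) ∧
        (∀ t : ℝ, 0 ≤ t → deriv φ t = 0 → t = 0) ∧
        φ 0 = 0 ∧ deriv φ 0 = 0 ∧ deriv (deriv φ) 0 = 1 ∧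
        Tendsto (fun t => deriv φ t / t) (nhdsWithin 0 (Ioi 0)) (nhds 1) ∧
        (∃ T c₀ c₁ c₂ : ℝ, ∀ t : ℝ, T ≤ t → φ t = c₀ + c₁ * t + c₂ * t ^ 2) ∧
        StrictAntiOn (fun t => deriv φ t / t) (Ioi 0) ∧
        (∃ L : ℝ, L < ϑ ∧ Tendsto (fun t => deriv φ t / t) atTop (nhds L)) ∧
        (∃ σ : ℝ, 0 < σ ∧ ∀ t : ℝ, 0 < t →
          σ ≤ min (deriv φ t / t) (deriv (deriv φ) t)) ∧
        StrictConvexOn ℝ (Ici 0) φ := by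
  refine ⟨1, one_pos, fun ϑ hϑ hϑ1 _ => ?_⟩
  set ε := ϑ / 2 with hεdef
  have hε : 0 < ε := by positivity
  obtain ⟨g, hg, hanti, hg0, hg1, hgε, hgT⟩ :=
    exists_smooth_antitone_eventually_const (ε := ε) (by linarith)
  have hc := hg.continuous
  set G : ℝ → ℝ := fun t => ∫ x in (0 : ℝ)..t, g x
  have hGs : ContDiff ℝ (⊤ : ℕ∞) G := contDiff_infty_primitive hg 0
  have hGc := hGs.continuous
  have hGd : ∀ t, HasDerivAt G (g t) t := fun t => (hc.integral_hasStrictDerivAt 0 t).hasDerivAt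
  set φ : ℝ → ℝ := fun t => ∫ x in (0 : ℝ)..t, G x
  have hφs : ContDiff ℝ (⊤ : ℕ∞) φ := contDiff_infty_primitive hGs 0
  have hφ' : deriv φ = G :=
    funext fun t => (hGc.integral_hasStrictDerivAt 0 t).hasDerivAt.deriv
  have hG' : deriv G = g := funext fun t => (hGd t).deriv
  have hG0 : G 0 = 0 := intervalIntegral.integral_same
  have hGlow : ∀ t, 0 ≤ t → ε * t ≤ G t := fun t ht => by
    have := intervalIntegral.integral_mono_on (f := fun _ => ε) (g := g) (μ := MeasureTheory.volume) ht
      (continuous_const.intervalIntegrable 0 t) (hc.intervalIntegrable 0 t) fun x _ => hgε x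
    simpa [mul_comm] using this
  have hGpos : ∀ t, 0 < t → 0 < G t := fun t ht => (mul_pos hε ht).trans_le (hGlow t ht.le)
  have hGT : ∀ t, 1 ≤ t → G t = G 1 + ε * (t - 1) := fun t ht => by
    have h1 : ∫ x in (1 : ℝ)..t, g x = ε * (t - 1) := by
      rw [intervalIntegral.integral_congr (g := fun _ => ε)
        fun x hx => hgT x (by rw [uIcc_of_le ht] at hx; exact hx.1)]
      simp [mul_comm]
    rw [← h1]
    exact (intervalIntegral.integral_add_adjacent_intervals (hc.intervalIntegrable _ _)
      (hc.intervalIntegrable _ _)).symm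
  have hφT : ∀ t, 1 ≤ t → φ t = φ 1 + G 1 * (t - 1) + ε * (t - 1) ^ 2 / 2 := fun t ht => by
    have h1 : ∫ x in (1 : ℝ)..t, G x = G 1 * (t - 1) + ε * (t - 1) ^ 2 / 2 := by
      rw [intervalIntegral.integral_congr (g := fun x => G 1 + ε * (x - 1))
        fun x hx => hGT x (by rw [uIcc_of_le ht] at hx; exact hx.1)]
      have hd : ∀ x ∈ uIcc 1 t, HasDerivAt
          (fun x => G 1 * (x - 1) + ε * (x - 1) ^ 2 / 2) (G 1 + ε * (x - 1)) x := fun x _ => by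
        have h := (hasDerivAt_id x).sub_const 1
        refine ((h.const_mul (G 1)).add (((h.pow 2).const_mul ε).div_const 2)).congr_deriv ?_
        simp only [id_eq]
        push_cast
        ring
      rw [intervalIntegral.integral_eq_sub_of_hasDerivAt hd
        (Continuous.intervalIntegrable (by fun_prop) _ _)]
      simp
    rw [add_assoc, ← h1]
    exact (intervalIntegral.integral_add_adjacent_intervals (hGc.intervalIntegrable _ _)
      (hGc.intervalIntegrable _ _)).symm
  refine ⟨φ, hφs, ?_, ?_, intervalIntegral.integral_same, ?_⟩
  · exact fun t ht => intervalIntegral.intervalIntegral_pos_of_pos_on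
      (hGc.intervalIntegrable 0 t) (fun x hx => hGpos x hx.1) ht
  · intro t ht h
    rw [hφ'] at h
    by_contra hne
    exact (hGpos t (lt_of_le_of_ne ht (Ne.symm hne))).ne' h
  rw [hφ', hG']
  refine ⟨hG0, hg0, ?_, ⟨1, φ 1 - G 1 + ε / 2, G 1 - ε, ε / 2, fun t ht => ?_⟩,
    strictAntiOn_integral_div hc (hanti.antitoneOn _) (by simpa [hg0] using hg1),
    ⟨ε, by linarith, ?_⟩, ⟨ε, hε, fun t ht => le_min ((le_div_iff₀ ht).2 (hGlow t ht.le)) (hgε t)⟩,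
    strictConvexOn_of_deriv2_pos' (convex_Ici 0) hφs.continuous.continuousOn fun t _ => ?_⟩
  · have h := (hasDerivAt_iff_tendsto_slope.1 (hGd 0)).mono_left
      (nhdsWithin_mono 0 fun t (ht : 0 < t) => ht.ne')
    rw [hg0] at h
    refine h.congr fun t => ?_
    simp [slope_def_field, hG0]
  · rw [hφT t ht]
    ring
  · have h : Tendsto (fun t : ℝ => ε + (G 1 - ε) / t) atTop (nhds (ε + 0)) :=
      tendsto_const_nhds.add (tendsto_const_nhds.div_atTop tendsto_id)
    rw [add_zero] at h
    refine h.congr' ?_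
    filter_upwards [eventually_ge_atTop 1] with t ht
    have : t ≠ 0 := by positivity
    rw [hGT t ht]
    field_simp
    ring
  · simpa [hφ', hG'] using hε.trans_le (hgε t)
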